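/- arXiv:2110.05426 — 2 statements merged into one kernel-verified Lean document; each statement's English description precedes it below -/
import Mathlib

section
/- Let p be a prime and let n ≥ 1 and r ≥ 1 be integers. For g ∈ GL_{2n−1}(ℤ_p) the following are equivalent: (i) g is upper triangular mod p^r; (ii) there exist h₁ ∈ GL_{n−1}(ℤ_p), h₂ ∈ GL_n(ℤ_p) with diag(h₁,h₂) ≡ 1 mod p^r, and an upper triangular b ∈ GL_{2n−1}(ℤ_p), such that g = u^{-1}·diag(h₁,h₂)·u·b. -/
/- We index `GL_{2n−1}` by `Fin (n-1) ⊕ Fin n` (top-left block of size `n−1`,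
bottom-right block of size `n`), with the order embedding `eF` into `Fin (2n−1)`
giving the usual linear ordering of the `2n−1` coordinates. -/

/-- The canonical order-embedding `Fin (n-1) ⊕ Fin n → Fin (2n-1)`. -/
def eF (n : ℕ) : Fin (n - 1) ⊕ Fin n → Fin (2 * n - 1) :=
  Sum.elim (fun a => ⟨(a : ℕ), by have := a.isLt; omega⟩)
    (fun a => ⟨n - 1 + (a : ℕ), by have := a.isLt; omega⟩)

/-- The `n × (n−1)` matrix `ξ`: first row zero, bottom `(n−1) × (n−1)` block the
antidiagonal matrix `w_{n−1}` (0-based: `ξ i j = 1` iff `i + j + 1 = n`). -/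
noncomputable def xiMat (p n : ℕ) [Fact p.Prime] : Matrix (Fin n) (Fin (n - 1)) ℤ_[p] :=
  fun i j => if (i : ℕ) + (j : ℕ) + 1 = n then 1 else 0

/-- The element `u ∈ GL_{2n−1}(ℤ_p)`: identity diagonal blocks, lower-left block
`ξ`, zero upper-right block. -/
noncomputable def uMat (p n : ℕ) [Fact p.Prime] :
    Matrix (Fin (n - 1) ⊕ Fin n) (Fin (n - 1) ⊕ Fin n) ℤ_[p] :=
  Matrix.fromBlocks 1 0 (xiMat p n) 1

/-- The block diagonal matrix `diag(h₁, h₂)`. -/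
noncomputable def blockDiag (p n : ℕ) [Fact p.Prime]
    (h₁ : Matrix (Fin (n - 1)) (Fin (n - 1)) ℤ_[p])
    (h₂ : Matrix (Fin n) (Fin n) ℤ_[p]) :
    Matrix (Fin (n - 1) ⊕ Fin n) (Fin (n - 1) ⊕ Fin n) ℤ_[p] :=
  Matrix.fromBlocks h₁ 0 0 h₂

open Matrix in
theorem aux_lu {R : Type*} [CommRing R] (I : Ideal R)
    (hI : ∀ x y : R, IsUnit x → y ∈ I → IsUnit (x - y)) :
    ∀ (m : ℕ) (M : Matrix (Fin m) (Fin m) R), (∀ i j, j < i → M i j ∈ I) →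
      (∀ i, IsUnit (M i i)) →
      ∃ L U : Matrix (Fin m) (Fin m) R, M = L * U ∧ (∀ i j, i < j → L i j = 0) ∧
        (∀ i j, L i j - (1 : Matrix (Fin m) (Fin m) R) i j ∈ I) ∧
        (∀ i j, j < i → U i j = 0) := by
  intro m
  induction m with
  | zero =>
    intro M _ _
    exact ⟨1, 1, by ext i; exact i.elim0, fun i => i.elim0, fun i => i.elim0, fun i => i.elim0⟩
  | succ m ih =>
    intro M hM hd
    obtain ⟨c, hc⟩ := (hd 0).exists_right_inv
    obtain ⟨L, U, hLU, hL, hL1, hU⟩ := ih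
      (fun i j => M i.succ j.succ - M i.succ 0 * c * M 0 j.succ)
      (fun i j hij => I.sub_mem (hM _ _ (Fin.succ_lt_succ_iff.2 hij))
        (I.mul_mem_right _ (I.mul_mem_right _ (hM _ _ (Fin.succ_pos i)))))
      (fun i => hI _ _ (hd _)
        (I.mul_mem_right _ (I.mul_mem_right _ (hM _ _ (Fin.succ_pos i)))))
    let L' : Matrix (Fin (m + 1)) (Fin (m + 1)) R := fun i j =>
      Fin.cases (Fin.cases 1 (fun _ => 0) j)
        (fun i' => Fin.cases (M i'.succ 0 * c) (fun j' => L i' j') j) i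
    let U' : Matrix (Fin (m + 1)) (Fin (m + 1)) R := fun i j =>
      Fin.cases (M 0 j) (fun i' => Fin.cases 0 (fun j' => U i' j') j) i
    refine ⟨L', U', ?_, ?_, ?_, ?_⟩
    · ext i j
      rw [Matrix.mul_apply, Fin.sum_univ_succ]
      refine Fin.cases ?_ (fun i => ?_) i
      · simp [L', U']
      · refine Fin.cases ?_ (fun j => ?_) j
        · simp [L', U']
          linear_combination (-M i.succ 0) * hc
        · have := congrFun (congrFun hLU i) j
          rw [Matrix.mul_apply] at this
          simp only [L', U', Fin.cases_succ, Fin.cases_zero]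
          rw [← this]; ring
    · intro i j
      refine Fin.cases ?_ (fun i => ?_) i <;> refine Fin.cases ?_ (fun j => ?_) j
      · simp [L', U']
      · simp [L', U']
      · simp [L', U']
      · intro h
        exact hL i j (Fin.succ_lt_succ_iff.1 h)
    · intro i j
      refine Fin.cases ?_ (fun i => ?_) i <;> refine Fin.cases ?_ (fun j => ?_) j
      · simp [L', U']
      · simp [L', (Fin.succ_ne_zero j).symm]
      · simp only [L', U', Fin.cases_succ, Fin.cases_zero, Matrix.one_apply, Fin.succ_ne_zero, if_false,
          sub_zero]
        exact I.mul_mem_right _ (hM _ _ (Fin.succ_pos i))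
      · have := hL1 i j
        simpa [L', Matrix.one_apply] using this
    · intro i j
      refine Fin.cases ?_ (fun i => ?_) i <;> refine Fin.cases ?_ (fun j => ?_) j
      · simp [L', U']
      · simp [L', U']
      · simp [L', U']
      · intro h
        exact hU i j (Fin.succ_lt_succ_iff.1 h)

theorem aux_map {R ι κ : Type*} [CommRing R] (I : Ideal R)
    (M N : Matrix ι κ R) : (∀ i j, M i j - N i j ∈ I) ↔
      M.map (Ideal.Quotient.mk I) = N.map (Ideal.Quotient.mk I) := by
  constructor
  · intro h; ext i j; exact Ideal.Quotient.eq.2 (h i j)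
  · intro h i j; exact Ideal.Quotient.eq.1 (congrFun (congrFun h i) j)

theorem aux_one {R ι : Type*} [CommRing R] [DecidableEq ι] (I : Ideal R) :
    (1 : Matrix ι ι R).map (Ideal.Quotient.mk I) = 1 := by
  simp

theorem aux_unit {R ι : Type*} [CommRing R] [Fintype ι] [DecidableEq ι] (I : Ideal R)
    (hI : ∀ x y : R, IsUnit x → y ∈ I → IsUnit (x - y)) (M : Matrix ι ι R)
    (h : M.map (Ideal.Quotient.mk I) = 1) : IsUnit M.det := by
  have h1 : Ideal.Quotient.mk I M.det = 1 := by
    rw [RingHom.map_det, RingHom.mapMatrix_apply, h, Matrix.det_one]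
  have h2 : (1 - M.det) ∈ I := by
    rw [← Ideal.Quotient.eq_zero_iff_mem]; simp [h1]
  simpa using hI 1 _ isUnit_one h2

theorem aux_inv {R ι : Type*} [CommRing R] [Fintype ι] [DecidableEq ι] (I : Ideal R)
    (hI : ∀ x y : R, IsUnit x → y ∈ I → IsUnit (x - y)) (M : Matrix ι ι R)
    (h : M.map (Ideal.Quotient.mk I) = 1) : (M⁻¹).map (Ideal.Quotient.mk I) = 1 := by
  have h1 := congrArg (fun X => X.map (Ideal.Quotient.mk I))
    (Matrix.mul_nonsing_inv M (aux_unit I hI M h))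
  simpa [Matrix.map_mul, h] using h1

theorem aux_tri_inv {R : Type*} [CommRing R] (m : ℕ) (M : Matrix (Fin m) (Fin m) R)
    (hd : IsUnit M.det) (hM : ∀ i j, j < i → M i j = 0) : ∀ i j, j < i → M⁻¹ i j = 0 := by
  letI := Matrix.invertibleOfIsUnitDet M hd
  have hb : M.BlockTriangular id := fun i j h => hM i j h
  have := Matrix.blockTriangular_inv_of_blockTriangular hb
  exact fun i j h => this h

theorem aux_xi {R : Type*} [CommRing R] (I : Ideal R)
    (hI : ∀ x y : R, IsUnit x → y ∈ I → IsUnit (x - y)) (m : ℕ)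
    (X N : Matrix (Fin (m + 1)) (Fin m) R)
    (hX : ∀ i j, X i j = if i = (Fin.rev j).succ then 1 else 0)
    (hN : N.map (Ideal.Quotient.mk I) = X.map (Ideal.Quotient.mk I)) :
    ∃ (T : Matrix (Fin (m + 1)) (Fin (m + 1)) R) (V : Matrix (Fin m) (Fin m) R),
      (∀ i j, j < i → T i j = 0) ∧ (∀ i j, j < i → V i j = 0) ∧
      T.map (Ideal.Quotient.mk I) = 1 ∧ V.map (Ideal.Quotient.mk I) = 1 ∧
      T * X * V = N := by
  have hN' := (aux_map I N X).2 hN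
  have hW : ∀ i j : Fin m, N (Fin.rev i).succ j - (1 : Matrix (Fin m) (Fin m) R) i j ∈ I := by
    intro i j
    have := hN' (Fin.rev i).succ j
    rw [hX] at this
    simpa [Matrix.one_apply] using this
  obtain ⟨L, V, hLV, hL, hL1, hV⟩ := aux_lu I hI m (fun i j => N (Fin.rev i).succ j)
    (fun i j h => by simpa [Matrix.one_apply, h.ne'] using hW i j)
    (fun i => by
      have h := I.neg_mem (hW i i)
      have := hI 1 _ isUnit_one h
      simpa using this)
  have hL1' := (aux_map I L 1).1 hL1
  rw [aux_one] at hL1'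
  have hV1 : V.map (Ideal.Quotient.mk I) = 1 := by
    have h1 := (aux_map I (fun i j => N (Fin.rev i).succ j) 1).1 hW
    rw [hLV, Matrix.map_mul, hL1', one_mul, aux_one] at h1
    exact h1
  have hVu := aux_unit I hI V hV1
  let e : Matrix (Fin 1) (Fin m) R := fun _ j => N 0 j
  have heI : ∀ j, (e * V⁻¹) 0 j ∈ I := by
    intro j
    rw [Matrix.mul_apply]
    refine I.sum_mem fun k _ => I.mul_mem_right _ ?_
    have := hN' 0 k
    rw [hX, if_neg (Fin.succ_ne_zero _).symm, sub_zero] at this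
    exact this
  let T : Matrix (Fin (m + 1)) (Fin (m + 1)) R := fun i j =>
    Fin.cases (Fin.cases 1 (fun j' => (e * V⁻¹) 0 (Fin.rev j')) j)
        (fun i' => Fin.cases 0 (fun j' => L (Fin.rev i') (Fin.rev j')) j) i
  have hTX : ∀ i j, (T * X) i j = T i (Fin.rev j).succ := by
    intro i j
    rw [Matrix.mul_apply]
    simp [hX]
  refine ⟨T, V, ?_, hV, ?_, hV1, ?_⟩
  · intro i j
    refine Fin.cases ?_ (fun i => ?_) i <;> refine Fin.cases ?_ (fun j => ?_) j
    · simp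
    · simp
    · simp [T]
    · intro h
      exact hL _ _ (Fin.rev_lt_rev.2 (Fin.succ_lt_succ_iff.1 h))
  · rw [← aux_one, ← aux_map]
    intro i j
    refine Fin.cases ?_ (fun i => ?_) i <;> refine Fin.cases ?_ (fun j => ?_) j
    · simp [T]
    · simpa [T, Matrix.one_apply, (Fin.succ_ne_zero j).symm] using heI (Fin.rev j)
    · simp [T, Matrix.one_apply]
    · have := hL1 (Fin.rev i) (Fin.rev j)
      simpa [T, Matrix.one_apply] using this
  · ext i j
    rw [Matrix.mul_apply]
    simp only [hTX]
    refine Fin.cases ?_ (fun i => ?_) i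
    · have h1 : (e * V⁻¹ * V) 0 j = N 0 j := by
        rw [Matrix.nonsing_inv_mul_cancel_right _ _ hVu]
      rw [Matrix.mul_apply] at h1
      simpa [T] using h1
    · have h1 := congrFun (congrFun hLV (Fin.rev i)) j
      rw [Matrix.mul_apply] at h1
      simpa [T] using h1.symm

theorem aux_eF_bij (n : ℕ) (hn : 1 ≤ n) : Function.Bijective (eF n) := by
  rw [Fintype.bijective_iff_injective_and_card]
  constructor
  · rintro (a | a) (b | b) h <;> simp [eF, Fin.ext_iff] at h ⊢ <;> omega
  · simp; omega

/-- LU decomposition of `g` in the block indexing. -/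
theorem aux_lu_sum {R : Type*} [CommRing R] (I : Ideal R)
    (hI : ∀ x y : R, IsUnit x → y ∈ I → IsUnit (x - y)) 
    (hJ : ∀ x : R, IsUnit (Ideal.Quotient.mk I x) → IsUnit x) (n : ℕ) (hn : 1 ≤ n)
    (g : Matrix (Fin (n - 1) ⊕ Fin n) (Fin (n - 1) ⊕ Fin n) R) (hg : IsUnit g.det)
    (h : ∀ i j, eF n j < eF n i → g i j ∈ I) :
    ∃ L U : Matrix (Fin (n - 1) ⊕ Fin n) (Fin (n - 1) ⊕ Fin n) R, g = L * U ∧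
      (∀ i j, eF n i < eF n j → L i j = 0) ∧
      L.map (Ideal.Quotient.mk I) = 1 ∧ (∀ i j, eF n j < eF n i → U i j = 0) := by
  let e := Equiv.ofBijective _ (aux_eF_bij n hn)
  have he : ∀ x, e x = eF n x := fun _ => rfl
  let M := g.submatrix e.symm e.symm
  have hM : ∀ i j, j < i → M i j ∈ I := by
    intro i j hij
    apply h
    rw [← he, ← he]; simpa using hij
  have hdet : IsUnit M.det := by rw [Matrix.det_submatrix_equiv_self]; exact hg
  have hd : ∀ i, IsUnit (M i i) := by
    have h1 : IsUnit (M.map (Ideal.Quotient.mk I)).det := by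
      have := hdet.map (Ideal.Quotient.mk I)
      rwa [RingHom.map_det] at this
    rw [Matrix.det_of_upperTriangular] at h1
    · intro i
      apply hJ
      exact (IsUnit.prod_univ_iff.1 h1) i
    · intro i j hij
      exact Ideal.Quotient.eq_zero_iff_mem.2 (hM i j hij)
  obtain ⟨L, U, hLU, hL, hL1, hU⟩ := aux_lu I hI _ M hM hd
  refine ⟨L.submatrix e e, U.submatrix e e, ?_, ?_, ?_, ?_⟩
  · rw [Matrix.submatrix_mul_equiv, ← hLU]; ext i j; simp [M]
  · intro i j hij; exact hL _ _ hij
  · rw [← aux_one, ← aux_map]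
    intro i j
    simpa [Matrix.one_apply] using hL1 (e i) (e j)
  · intro i j hij; exact hU _ _ hij

theorem aux_main {R : Type*} [CommRing R] (I : Ideal R)
    (hI : ∀ x y : R, IsUnit x → y ∈ I → IsUnit (x - y)) 
    (hJ : ∀ x : R, IsUnit (Ideal.Quotient.mk I x) → IsUnit x) (m : ℕ)
    (X : Matrix (Fin (m + 1)) (Fin m) R)
    (hX : ∀ i j, X i j = if i = (Fin.rev j).succ then 1 else 0)
    (g : Matrix (Fin m ⊕ Fin (m + 1)) (Fin m ⊕ Fin (m + 1)) R) (hg : IsUnit g.det)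
    (h : ∀ i j, eF (m + 1) j < eF (m + 1) i → g i j ∈ I) :
    ∃ (h₁ : Matrix (Fin m) (Fin m) R) (h₂ : Matrix (Fin (m + 1)) (Fin (m + 1)) R)
      (b : Matrix (Fin m ⊕ Fin (m + 1)) (Fin m ⊕ Fin (m + 1)) R),
      h₁.map (Ideal.Quotient.mk I) = 1 ∧ h₂.map (Ideal.Quotient.mk I) = 1 ∧
      (∀ i j, eF (m + 1) j < eF (m + 1) i → b i j = 0) ∧
      Matrix.fromBlocks 1 0 X 1 * g =
        Matrix.fromBlocks h₁ 0 0 h₂ * Matrix.fromBlocks 1 0 X 1 * b := by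
  obtain ⟨L, U, hLU, hL, hL1, hU⟩ := aux_lu_sum I hI hJ (m + 1) (by omega) g hg h
  have hlt : ∀ (a : Fin m) (b : Fin (m + 1)),
      eF (m + 1) (Sum.inl a) < eF (m + 1) (Sum.inr b) := by
    intro a b; simp [eF, Fin.lt_def]; omega
  have hll : ∀ (a b : Fin m),
      eF (m + 1) (Sum.inl a) < eF (m + 1) (Sum.inl b) ↔ a < b := by
    intro a b; simp [eF]
  have hrr : ∀ (a b : Fin (m + 1)),
      eF (m + 1) (Sum.inr a) < eF (m + 1) (Sum.inr b) ↔ a < b := by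
    intro a b; simp [eF]
  change Matrix (Fin m ⊕ Fin (m + 1)) (Fin m ⊕ Fin (m + 1)) R at L U
  have hB : ∃ A C D, L = Matrix.fromBlocks A 0 C D := by
    refine ⟨L.toBlocks₁₁, L.toBlocks₂₁, L.toBlocks₂₂, ?_⟩
    conv_lhs => rw [← Matrix.fromBlocks_toBlocks L]
    congr 1
    ext i j; exact hL _ _ (hlt i j)
  obtain ⟨A, C, D, rfl⟩ := hB
  have hL1' : Matrix.fromBlocks (A.map (Ideal.Quotient.mk I)) 0 (C.map (Ideal.Quotient.mk I))
      (D.map (Ideal.Quotient.mk I)) = Matrix.fromBlocks 1 0 0 1 := by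
    rw [Matrix.fromBlocks_one, ← hL1, Matrix.fromBlocks_map]
    simp
  rw [Matrix.fromBlocks_inj] at hL1'
  obtain ⟨hA, -, hC, hD⟩ := hL1'
  have hDu := aux_unit I hI D hD
  obtain ⟨T, V, hT, hV, hT1, hV1, hTV⟩ := aux_xi I hI m X (D⁻¹ * (X * A + C)) hX (by
    rw [Matrix.map_mul, aux_inv I hI D hD, Matrix.one_mul, Matrix.map_add _ (by simp), Matrix.map_mul,
      hA, hC]; simp)
  have hTu := aux_unit I hI T hT1
  have hVu := aux_unit I hI V hV1
  refine ⟨A * V⁻¹, D * T, Matrix.fromBlocks V 0 0 T⁻¹ * U, ?_, ?_, ?_, ?_⟩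
  · rw [Matrix.map_mul, hA, aux_inv I hI V hV1, one_mul]
  · rw [Matrix.map_mul, hD, hT1, one_mul]
  · have hTi := aux_tri_inv _ T hTu hT
    have hb : Matrix.BlockTriangular (Matrix.fromBlocks V 0 0 T⁻¹) (eF (m + 1)) := by
      rintro (i | i) (j | j) hij
      · exact hV _ _ ((hll _ _).1 hij)
      · rfl
      · rfl
      · exact hTi _ _ ((hrr _ _).1 hij)
    have hU' : Matrix.BlockTriangular U (eF (m + 1)) := fun i j hij => hU i j hij
    exact fun i j hij => (hb.mul hU') hij
  · have e1 : D * T * X * V = X * A + C := by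
      rw [Matrix.mul_assoc D, Matrix.mul_assoc D, hTV, Matrix.mul_nonsing_inv_cancel_left _ _ hDu]
    rw [hLU, ← Matrix.mul_assoc, ← Matrix.mul_assoc]
    congr 1
    simp only [Matrix.fromBlocks_multiply, Matrix.mul_zero, Matrix.zero_mul, Matrix.one_mul,
      Matrix.mul_one, add_zero, zero_add]
    rw [e1, Matrix.nonsing_inv_mul_cancel_right _ _ hVu,
      Matrix.mul_nonsing_inv_cancel_right _ _ hTu]

/-- For `g ∈ GL_{2n−1}(ℤ_p)`: `g` is upper triangular mod `p^r`
iff `g = u⁻¹·diag(h₁,h₂)·u·b` with `diag(h₁,h₂) ≡ 1 mod p^r` and `b` upper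
triangular. -/
theorem stmt5 (p : ℕ) [Fact p.Prime] (n r : ℕ) (hn : 1 ≤ n) (hr : 1 ≤ r)
    (g : GL (Fin (n - 1) ⊕ Fin n) ℤ_[p]) :
    (∀ i j : Fin (n - 1) ⊕ Fin n, eF n j < eF n i →
      (p : ℤ_[p]) ^ r ∣
        (g : Matrix (Fin (n - 1) ⊕ Fin n) (Fin (n - 1) ⊕ Fin n) ℤ_[p]) i j) ↔
    (∃ (h₁ : GL (Fin (n - 1)) ℤ_[p]) (h₂ : GL (Fin n) ℤ_[p])
        (b : GL (Fin (n - 1) ⊕ Fin n) ℤ_[p]),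
      (∀ i j : Fin (n - 1) ⊕ Fin n, (p : ℤ_[p]) ^ r ∣
        (blockDiag p n (h₁ : Matrix (Fin (n - 1)) (Fin (n - 1)) ℤ_[p])
            (h₂ : Matrix (Fin n) (Fin n) ℤ_[p]) i j
          - (1 : Matrix (Fin (n - 1) ⊕ Fin n) (Fin (n - 1) ⊕ Fin n) ℤ_[p]) i j)) ∧
      (∀ i j : Fin (n - 1) ⊕ Fin n, eF n j < eF n i →
        (b : Matrix (Fin (n - 1) ⊕ Fin n) (Fin (n - 1) ⊕ Fin n) ℤ_[p]) i j = 0) ∧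
      (g : Matrix (Fin (n - 1) ⊕ Fin n) (Fin (n - 1) ⊕ Fin n) ℤ_[p]) =
        (uMat p n)⁻¹ *
          blockDiag p n (h₁ : Matrix (Fin (n - 1)) (Fin (n - 1)) ℤ_[p])
            (h₂ : Matrix (Fin n) (Fin n) ℤ_[p]) *
          uMat p n *
          (b : Matrix (Fin (n - 1) ⊕ Fin n) (Fin (n - 1) ⊕ Fin n) ℤ_[p])) := by
  obtain ⟨m, rfl⟩ : ∃ m, n = m + 1 := ⟨n - 1, by omega⟩
  let I : Ideal ℤ_[p] := Ideal.span {(p : ℤ_[p]) ^ r}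
  have hmem : ∀ x, x ∈ I ↔ (p : ℤ_[p]) ^ r ∣ x := fun x => Ideal.mem_span_singleton
  have hImax : I ≤ IsLocalRing.maximalIdeal ℤ_[p] := by
    rw [PadicInt.maximalIdeal_eq_span_p, Ideal.span_singleton_le_span_singleton]
    exact dvd_pow_self _ (by omega)
  have hI : ∀ x y : ℤ_[p], IsUnit x → y ∈ I → IsUnit (x - y) := by
    intro x y hx hy
    by_contra hxy
    have h1 : x - y ∈ IsLocalRing.maximalIdeal ℤ_[p] := (IsLocalRing.mem_maximalIdeal _).2 hxy
    have h2 := Ideal.add_mem _ h1 (hImax hy)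
    rw [sub_add_cancel] at h2
    exact (IsLocalRing.mem_maximalIdeal _).1 h2 hx
  have hJ : ∀ x : ℤ_[p], IsUnit (Ideal.Quotient.mk I x) → IsUnit x := by
    intro x hx
    obtain ⟨c, hc⟩ := hx.exists_right_inv
    obtain ⟨c, rfl⟩ := Ideal.Quotient.mk_surjective c
    rw [← map_mul, ← map_one (Ideal.Quotient.mk I), Ideal.Quotient.eq] at hc
    have := hI 1 _ isUnit_one (I.neg_mem hc)
    simp at this
    exact this.1
  have hX : ∀ i (j : Fin m), xiMat p (m + 1) i j = if i = (Fin.rev j).succ then 1 else 0 := by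
    intro i j
    have : ((i : ℕ) + (j : ℕ) + 1 = m + 1) ↔ i = (Fin.rev j).succ := by
      rw [Fin.ext_iff]; simp [Fin.val_rev]; omega
    simp only [xiMat, this]
  have hu : IsUnit (uMat p (m + 1)).det := by
    unfold uMat
    rw [Matrix.det_fromBlocks_zero₁₂]; simp
  have hgu : IsUnit (g : Matrix (Fin (m + 1 - 1) ⊕ Fin (m + 1)) (Fin (m + 1 - 1) ⊕ Fin (m + 1)) ℤ_[p]).det :=
    (Matrix.isUnit_iff_isUnit_det _).1 g.isUnit
  constructor
  · intro h
    obtain ⟨h₁, h₂, b, e1, e2, hb, heq⟩ := aux_main I hI hJ m (xiMat p (m + 1)) hX _ hgu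
      (fun i j hij => (hmem _).2 (h i j hij))
    change Matrix (Fin (m + 1 - 1)) (Fin (m + 1 - 1)) ℤ_[p] at h₁
    change Matrix (Fin (m + 1 - 1) ⊕ Fin (m + 1)) (Fin (m + 1 - 1) ⊕ Fin (m + 1)) ℤ_[p] at b
    have heq' : uMat p (m + 1) * (g : Matrix (Fin (m + 1 - 1) ⊕ Fin (m + 1)) (Fin (m + 1 - 1) ⊕ Fin (m + 1)) ℤ_[p]) =
      blockDiag p (m + 1) h₁ h₂ * uMat p (m + 1) * b := heq
    have hbu : IsUnit b.det := by
      have h1 := congrArg Matrix.det heq'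
      rw [Matrix.det_mul, Matrix.det_mul] at h1
      have h2 := hu.mul hgu
      rw [h1] at h2
      exact isUnit_of_mul_isUnit_right h2
    refine ⟨Matrix.nonsingInvUnit h₁ (aux_unit I hI _ e1),
      Matrix.nonsingInvUnit h₂ (aux_unit I hI _ e2), Matrix.nonsingInvUnit b hbu, ?_, hb, ?_⟩
    · intro i j
      rw [← hmem]
      revert i j
      rw [aux_map, aux_one]
      change (Matrix.fromBlocks h₁ 0 0 h₂).map _ = 1
      rw [Matrix.fromBlocks_map, e1, e2]
      simp
    · change _ = (uMat p (m + 1))⁻¹ * blockDiag p (m + 1) h₁ h₂ * uMat p (m + 1) * b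
      rw [Matrix.mul_assoc, Matrix.mul_assoc, ← Matrix.mul_assoc (blockDiag p (m + 1) h₁ h₂),
        ← heq', Matrix.nonsing_inv_mul_cancel_left _ _ hu]
  · rintro ⟨h₁, h₂, b, h1, hb, heq⟩ i j hij
    have h1' := (aux_map I _ _).1 (fun i j => (hmem _).2 (h1 i j))
    rw [aux_one] at h1'
    rw [← hmem, ← sub_zero (Units.val g i j), ← hb i j hij]
    revert i j
    have key : (g : Matrix (Fin (m + 1 - 1) ⊕ Fin (m + 1)) (Fin (m + 1 - 1) ⊕ Fin (m + 1)) ℤ_[p]).map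
        (Ideal.Quotient.mk I) = b.val.map (Ideal.Quotient.mk I) := by
      have h3 := congrArg (fun X => X.map (Ideal.Quotient.mk I))
        (Matrix.nonsing_inv_mul _ hu)
      simp only [Matrix.map_mul, aux_one] at h3
      rw [heq, Matrix.map_mul, Matrix.map_mul, Matrix.map_mul, h1', Matrix.mul_one, h3,
        Matrix.one_mul]
    intro i j _
    exact (aux_map I _ _).2 key i j
end

section
/- Fix integers n ≥ 2 and d ≥ 1 and a finite set Ψ of cardinality d with distinguished element τ₀. Then for every pair (κ, j) ∈ 𝓔 there exist unique integers a_0 and a_{1,τ₀}, unique nonnegative integers a_w, a_{n+1,τ₀}, and a_{i,τ} for all pairs (i,τ) with 1 ≤ i ≤ n, τ ∈ Ψ and (i,τ) ≠ (1,τ₀), and unique nonnegative integers b_τ for τ ≠ τ₀, such that (κ, j) = a_0·(μ_0, 0) + a_w·(μ_w, 0) + a_{n+1,τ₀}·(μ_{n+1,τ₀}, 0) + Σ_{i=1}^{n} Σ_{τ∈Ψ} a_{i,τ}·(μ_{i,τ}, 0) + Σ_{τ≠τ₀} b_τ·(μ_{n,τ}, 1_τ) (componentwise addition of pairs). -/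
/- A weight is a pair `(κ_0, (κ_{i,τ}))` in `ℤ × (Ψ → Fin (2*n) → ℤ)`, with the
`Fin (2*n)` coordinate 0-based (so the 1-based index `i` of the paper is `i-1`
here).  Elements of `𝒟` are tuples indexed by `{τ // τ ≠ τ₀}`.  The generators
`μ_0, μ_w, μ_{n+1,τ₀}, μ_{i,τ}` and `1_τ` are as in the appendix on branching
laws. -/

/-- The generator `μ_0` (entry `1` in the `GL_1`-component). -/
def mu0 (n : ℕ) (Ψ : Type*) : ℤ × (Ψ → Fin (2 * n) → ℤ) := (1, 0)

/-- The generator `μ_w`: entry `−1` at `(i, τ₀)` for 1-based `n+1 ≤ i ≤ 2n`. -/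
def muW (n : ℕ) {Ψ : Type*} [DecidableEq Ψ] (τ₀ : Ψ) : ℤ × (Ψ → Fin (2 * n) → ℤ) :=
  (0, fun τ k => if τ = τ₀ ∧ n ≤ (k : ℕ) then -1 else 0)

/-- The generator `μ_{n+1,τ₀}`: entry `1` at `(k, τ₀)` for 1-based `2 ≤ k ≤ n`,
entry `−1` at `(k, τ₀)` for 1-based `n+1 ≤ k ≤ 2n`. -/
def muNp1 (n : ℕ) {Ψ : Type*} [DecidableEq Ψ] (τ₀ : Ψ) : ℤ × (Ψ → Fin (2 * n) → ℤ) :=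
  (0, fun τ k => if τ = τ₀ then
        (if 1 ≤ (k : ℕ) ∧ (k : ℕ) < n then 1 else if n ≤ (k : ℕ) then -1 else 0)
      else 0)

/-- The generators `μ_{i,τ}` for `1 ≤ i ≤ n` (here `i : Fin n` is the 1-based
index `i+1`). -/
def muGen (n : ℕ) {Ψ : Type*} [DecidableEq Ψ] (τ₀ τ : Ψ) (i : Fin n) :
    ℤ × (Ψ → Fin (2 * n) → ℤ) :=
  (0, fun τ' k =>
    if τ' = τ then
      (if τ = τ₀ then
        (if (i : ℕ) = 0 then (if (k : ℕ) = 0 then 1 else 0)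
         else
          (if 1 ≤ (k : ℕ) ∧ (k : ℕ) ≤ (i : ℕ) then 1
           else if 2 * n - (i : ℕ) ≤ (k : ℕ) then -1 else 0))
      else
        (if (k : ℕ) ≤ (i : ℕ) then 1
         else if 2 * n - 1 - (i : ℕ) ≤ (k : ℕ) then -1 else 0))
    else 0)

/-- The tuple `1_τ ∈ 𝒟`: entry `1` at `τ` and `0` elsewhere. -/
def oneAt {Ψ : Type*} [DecidableEq Ψ] (τ₀ : Ψ) (τ : {τ' : Ψ // τ' ≠ τ₀}) :
    {τ' : Ψ // τ' ≠ τ₀} → ℤ :=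
  fun τ' => if τ' = τ then 1 else 0

/-- Tail sum. -/
def tailS {n : ℕ} (a : Fin n → ℤ) (k : ℕ) : ℤ := ∑ i : Fin n, if k ≤ (i : ℕ) then a i else 0

theorem tailS_ge {n : ℕ} (a : Fin n → ℤ) (k : ℕ) (h : n ≤ k) : tailS a k = 0 := by
  unfold tailS
  apply Finset.sum_eq_zero
  intro i _
  rw [if_neg]
  have := i.isLt
  omega

theorem tailS_succ {n : ℕ} (a : Fin n → ℤ) (i : Fin n) :
    tailS a i = a i + tailS a (i + 1) := by
  unfold tailS
  have : a i = ∑ x : Fin n, if x = i then a x else 0 := by simp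
  rw [this, ← Finset.sum_add_distrib]
  apply Finset.sum_congr rfl
  intro x _
  rcases lt_trichotomy (x : ℕ) (i : ℕ) with h | h | h
  · have : x ≠ i := by rintro rfl; omega
    simp [this]; omega
  · have : x = i := Fin.ext h
    subst this; simp
  · have : x ≠ i := by rintro rfl; omega
    have h1 : (i : ℕ) ≤ x := by omega
    have h2 : (i : ℕ) + 1 ≤ x := by omega
    simp only [this, h1, h2, if_true, if_false]; omega

theorem tailS_tele {n : ℕ} (a : Fin n → ℤ) (g : ℕ → ℤ) (m : ℕ)
    (h : ∀ i : Fin n, m ≤ (i : ℕ) → a i = g i - g (i + 1)) (k : ℕ) (hm : m ≤ k) (hk : k ≤ n) :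
    tailS a k = g k - g n := by
  induction hk using Nat.decreasingInduction with
  | self => rw [tailS_ge a n le_rfl]; ring
  | of_succ k hk ih =>
    have h1 := tailS_succ a ⟨k, hk⟩
    have h2 := h ⟨k, hk⟩ hm
    have h3 := ih (by omega)
    simp only at h1 h2
    rw [h1, h2, h3]; ring

theorem comp_ne {n : ℕ} (hn : 2 ≤ n) {Ψ : Type*} [Fintype Ψ] [DecidableEq Ψ] (τ₀ : Ψ)
    (A : Ψ → Fin n → ℤ) (b : {τ' : Ψ // τ' ≠ τ₀} → ℤ) (z w c : ℤ) (τ : Ψ) (hτ : τ ≠ τ₀)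
    (k : Fin (2 * n)) :
    (z • (mu0 n Ψ, (0 : {τ' : Ψ // τ' ≠ τ₀} → ℤ)) +
        w • (muW n τ₀, (0 : {τ' : Ψ // τ' ≠ τ₀} → ℤ)) +
        c • (muNp1 n τ₀, (0 : {τ' : Ψ // τ' ≠ τ₀} → ℤ)) +
        (∑ τ : Ψ, ∑ i : Fin n,
          A τ i • (muGen n τ₀ τ i, (0 : {τ' : Ψ // τ' ≠ τ₀} → ℤ))) +
        (∑ τ : {τ' : Ψ // τ' ≠ τ₀},
          b τ • (muGen n τ₀ τ.1 ⟨n - 1, by omega⟩, oneAt τ₀ τ))).1.2 τ k =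
      if (k : ℕ) < n then tailS (A τ) k + b ⟨τ, hτ⟩
      else -(tailS (A τ) (2 * n - 1 - k) + b ⟨τ, hτ⟩) := by
  have hk := k.isLt
  have e1 : (∑ τ' : Ψ, ∑ i : Fin n, A τ' i * (muGen n τ₀ τ' i).2 τ k) =
      if (k : ℕ) < n then tailS (A τ) k else -tailS (A τ) (2 * n - 1 - k) := by
    rw [Finset.sum_eq_single τ]
    · split_ifs with h
      · unfold tailS
        apply Finset.sum_congr rfl
        intro i _
        have := i.isLt
        simp only [muGen, hτ, if_true, if_false]
        split_ifs <;> first | omega | simp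
      · unfold tailS
        rw [← Finset.sum_neg_distrib]
        apply Finset.sum_congr rfl
        intro i _
        have := i.isLt
        simp only [muGen, hτ, if_true, if_false]
        split_ifs <;> first | omega | simp
    · intro τ' _ h
      simp [muGen, h.symm]
    · simp
  have e2 : (∑ τ' : {τ' : Ψ // τ' ≠ τ₀}, b τ' * (muGen n τ₀ τ'.1 ⟨n - 1, by omega⟩).2 τ k) =
      if (k : ℕ) < n then b ⟨τ, hτ⟩ else -b ⟨τ, hτ⟩ := by
    rw [Finset.sum_eq_single ⟨τ, hτ⟩]
    · simp only [muGen, hτ, if_true, if_false]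
      split_ifs <;> first | omega | simp
    · intro τ' _ h
      have : τ ≠ τ'.1 := fun e => h (Subtype.ext e.symm)
      simp [muGen, this]
    · simp
  simp only [Prod.fst_add, Prod.snd_add, Prod.smul_fst, Prod.smul_snd, Prod.fst_sum,
    Prod.snd_sum, Pi.add_apply, Pi.smul_apply, Finset.sum_apply, smul_eq_mul, e1, e2]
  simp only [mu0, muW, muNp1, hτ, Pi.zero_apply]
  split_ifs <;> simp_all <;> ring

theorem comp_eq {n : ℕ} (hn : 2 ≤ n) {Ψ : Type*} [Fintype Ψ] [DecidableEq Ψ] (τ₀ : Ψ)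
    (A : Ψ → Fin n → ℤ) (b : {τ' : Ψ // τ' ≠ τ₀} → ℤ) (z w c : ℤ)
    (k : Fin (2 * n)) :
    (z • (mu0 n Ψ, (0 : {τ' : Ψ // τ' ≠ τ₀} → ℤ)) +
        w • (muW n τ₀, (0 : {τ' : Ψ // τ' ≠ τ₀} → ℤ)) +
        c • (muNp1 n τ₀, (0 : {τ' : Ψ // τ' ≠ τ₀} → ℤ)) +
        (∑ τ : Ψ, ∑ i : Fin n,
          A τ i • (muGen n τ₀ τ i, (0 : {τ' : Ψ // τ' ≠ τ₀} → ℤ))) +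
        (∑ τ : {τ' : Ψ // τ' ≠ τ₀},
          b τ • (muGen n τ₀ τ.1 ⟨n - 1, by omega⟩, oneAt τ₀ τ))).1.2 τ₀ k =
      if (k : ℕ) = 0 then A τ₀ ⟨0, by omega⟩ else if (k : ℕ) < n then c + tailS (A τ₀) k
      else -w - c - tailS (A τ₀) (2 * n - k) := by
  have hk := k.isLt
  have e1 : (∑ τ' : Ψ, ∑ i : Fin n, A τ' i * (muGen n τ₀ τ' i).2 τ₀ k) =
      if (k : ℕ) = 0 then A τ₀ ⟨0, by omega⟩ else
      if (k : ℕ) < n then tailS (A τ₀) k else -tailS (A τ₀) (2 * n - k) := by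
    rw [Finset.sum_eq_single τ₀]
    · split_ifs with h0 h
      · rw [Finset.sum_eq_single ⟨0, by omega⟩]
        · simp [muGen, h0]
        · intro i _ hi
          have hi' : (i : ℕ) ≠ 0 := fun e => hi (Fin.ext e)
          have := i.isLt
          simp only [muGen, if_true]
          split_ifs <;> first | omega | simp
        · simp
      · unfold tailS
        apply Finset.sum_congr rfl
        intro i _
        have := i.isLt
        simp only [muGen, if_true]
        split_ifs <;> first | omega | simp
      · unfold tailS
        rw [← Finset.sum_neg_distrib]
        apply Finset.sum_congr rfl
        intro i _
        have := i.isLt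
        simp only [muGen, if_true]
        split_ifs <;> first | omega | simp
    · intro τ' _ h
      simp [muGen, h.symm]
    · simp
  have e2 : (∑ τ' : {τ' : Ψ // τ' ≠ τ₀}, b τ' * (muGen n τ₀ τ'.1 ⟨n - 1, by omega⟩).2 τ₀ k) =
      0 := by
    apply Finset.sum_eq_zero
    intro τ' _
    simp [muGen, τ'.2.symm]
  simp only [Prod.fst_add, Prod.snd_add, Prod.smul_fst, Prod.smul_snd, Prod.fst_sum,
    Prod.snd_sum, Pi.add_apply, Pi.smul_apply, Finset.sum_apply, smul_eq_mul, e1, e2]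
  simp only [mu0, muW, muNp1, Pi.zero_apply, true_and, if_true]
  split_ifs <;> first | omega | (simp_all; done) | (simp_all; ring)

theorem comp_iff {n : ℕ} (hn : 2 ≤ n) {Ψ : Type*} [Fintype Ψ] [DecidableEq Ψ] (τ₀ : Ψ)
    (κ : ℤ × (Ψ → Fin (2 * n) → ℤ)) (j : {τ' : Ψ // τ' ≠ τ₀} → ℤ)
    (A : Ψ → Fin n → ℤ) (b : {τ' : Ψ // τ' ≠ τ₀} → ℤ) (z w c : ℤ) :
    ((κ, j) = z • (mu0 n Ψ, (0 : {τ' : Ψ // τ' ≠ τ₀} → ℤ)) +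
        w • (muW n τ₀, (0 : {τ' : Ψ // τ' ≠ τ₀} → ℤ)) +
        c • (muNp1 n τ₀, (0 : {τ' : Ψ // τ' ≠ τ₀} → ℤ)) +
        (∑ τ : Ψ, ∑ i : Fin n,
          A τ i • (muGen n τ₀ τ i, (0 : {τ' : Ψ // τ' ≠ τ₀} → ℤ))) +
        (∑ τ : {τ' : Ψ // τ' ≠ τ₀},
          b τ • (muGen n τ₀ τ.1 ⟨n - 1, by omega⟩, oneAt τ₀ τ))) ↔
      κ.1 = z ∧ j = b ∧
      (∀ k : Fin (2 * n), κ.2 τ₀ k = if (k : ℕ) = 0 then A τ₀ ⟨0, by omega⟩ else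
        if (k : ℕ) < n then c + tailS (A τ₀) k else -w - c - tailS (A τ₀) (2 * n - k)) ∧
      (∀ (τ : Ψ) (hτ : τ ≠ τ₀) (k : Fin (2 * n)), κ.2 τ k =
        if (k : ℕ) < n then tailS (A τ) k + b ⟨τ, hτ⟩
        else -(tailS (A τ) (2 * n - 1 - k) + b ⟨τ, hτ⟩)) := by
  simp only [← comp_ne hn τ₀ A b z w c, ← comp_eq hn τ₀ A b z w c]
  have h2 : (z • (mu0 n Ψ, (0 : {τ' : Ψ // τ' ≠ τ₀} → ℤ)) +
        w • (muW n τ₀, (0 : {τ' : Ψ // τ' ≠ τ₀} → ℤ)) +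
        c • (muNp1 n τ₀, (0 : {τ' : Ψ // τ' ≠ τ₀} → ℤ)) +
        (∑ τ : Ψ, ∑ i : Fin n,
          A τ i • (muGen n τ₀ τ i, (0 : {τ' : Ψ // τ' ≠ τ₀} → ℤ))) +
        (∑ τ : {τ' : Ψ // τ' ≠ τ₀},
          b τ • (muGen n τ₀ τ.1 ⟨n - 1, by omega⟩, oneAt τ₀ τ))).2 = b := by
    funext τ
    simp [Prod.snd_sum, oneAt]
  have h1 : (z • (mu0 n Ψ, (0 : {τ' : Ψ // τ' ≠ τ₀} → ℤ)) +
        w • (muW n τ₀, (0 : {τ' : Ψ // τ' ≠ τ₀} → ℤ)) +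
        c • (muNp1 n τ₀, (0 : {τ' : Ψ // τ' ≠ τ₀} → ℤ)) +
        (∑ τ : Ψ, ∑ i : Fin n,
          A τ i • (muGen n τ₀ τ i, (0 : {τ' : Ψ // τ' ≠ τ₀} → ℤ))) +
        (∑ τ : {τ' : Ψ // τ' ≠ τ₀},
          b τ • (muGen n τ₀ τ.1 ⟨n - 1, by omega⟩, oneAt τ₀ τ))).1.1 = z := by
    simp [Prod.fst_sum, mu0, muW, muNp1, muGen]
  generalize (z • (mu0 n Ψ, (0 : {τ' : Ψ // τ' ≠ τ₀} → ℤ)) +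
        w • (muW n τ₀, (0 : {τ' : Ψ // τ' ≠ τ₀} → ℤ)) +
        c • (muNp1 n τ₀, (0 : {τ' : Ψ // τ' ≠ τ₀} → ℤ)) +
        (∑ τ : Ψ, ∑ i : Fin n,
          A τ i • (muGen n τ₀ τ i, (0 : {τ' : Ψ // τ' ≠ τ₀} → ℤ))) +
        (∑ τ : {τ' : Ψ // τ' ≠ τ₀},
          b τ • (muGen n τ₀ τ.1 ⟨n - 1, by omega⟩, oneAt τ₀ τ))) = X at h1 h2 ⊢
  constructor
  · rintro rfl
    exact ⟨h1, h2, fun _ => rfl, fun _ _ _ => rfl⟩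
  · rintro ⟨a1, a2, a3, a4⟩
    refine Prod.ext (Prod.ext (a1.trans h1.symm) ?_) (a2.trans h2.symm)
    funext τ k
    by_cases hτ : τ = τ₀
    · subst hτ; exact a3 k
    · exact a4 τ hτ k

/-- Every pair `(κ, j) ∈ 𝓔` (i.e. `κ ∈ 𝒞` and
`0 ≤ j_τ ≤ κ_{n,τ}` for all `τ ≠ τ₀`) decomposes uniquely as
`(κ, j) = a_0·(μ_0,0) + a_w·(μ_w,0) + a_{n+1,τ₀}·(μ_{n+1,τ₀},0)
+ Σ_{i=1}^{n} Σ_{τ∈Ψ} a_{i,τ}·(μ_{i,τ},0) + Σ_{τ≠τ₀} b_τ·(μ_{n,τ},1_τ)`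
with `a_0, a_{1,τ₀} ∈ ℤ` and all other coefficients nonnegative. -/
theorem stmt16 (n d : ℕ) (hn : 2 ≤ n) (hd : 1 ≤ d)
    (Ψ : Type*) [Fintype Ψ] [DecidableEq Ψ] (hΨ : Fintype.card Ψ = d) (τ₀ : Ψ)
    (κ : ℤ × (Ψ → Fin (2 * n) → ℤ)) (j : {τ' : Ψ // τ' ≠ τ₀} → ℤ)
    (hdom₀ : ∀ i j' : Fin (2 * n), 1 ≤ (i : ℕ) → (i : ℕ) ≤ (j' : ℕ) →
      κ.2 τ₀ j' ≤ κ.2 τ₀ i)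
    (hdom : ∀ τ : Ψ, τ ≠ τ₀ → ∀ i j' : Fin (2 * n), (i : ℕ) ≤ (j' : ℕ) →
      κ.2 τ j' ≤ κ.2 τ i)
    (w : ℤ) (hw : w ≤ 0)
    (hpure₀ : ∀ i : Fin (2 * n), ∀ _h1 : 1 ≤ (i : ℕ), ∀ _h2 : (i : ℕ) < n,
      κ.2 τ₀ i + κ.2 τ₀ ⟨2 * n - (i : ℕ), by have := i.isLt; omega⟩ = w)
    (hpure : ∀ τ : Ψ, τ ≠ τ₀ → ∀ i : Fin (2 * n), κ.2 τ i + κ.2 τ i.rev = 0)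
    (hmid : κ.2 τ₀ ⟨n, by omega⟩ ≤ w)
    (hj : ∀ τ : {τ' : Ψ // τ' ≠ τ₀}, 0 ≤ j τ ∧ j τ ≤ κ.2 τ.1 ⟨n - 1, by omega⟩) :
    ∃! Z : (ℤ × ℤ × ℤ × (Ψ → Fin n → ℤ)) × ({τ' : Ψ // τ' ≠ τ₀} → ℤ),
      (0 ≤ Z.1.2.1 ∧ 0 ≤ Z.1.2.2.1 ∧
        (∀ (τ : Ψ) (i : Fin n), (τ ≠ τ₀ ∨ (i : ℕ) ≠ 0) → 0 ≤ Z.1.2.2.2 τ i) ∧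
        (∀ τ : {τ' : Ψ // τ' ≠ τ₀}, 0 ≤ Z.2 τ)) ∧
      (κ, j) =
        Z.1.1 • (mu0 n Ψ, (0 : {τ' : Ψ // τ' ≠ τ₀} → ℤ)) +
        Z.1.2.1 • (muW n τ₀, (0 : {τ' : Ψ // τ' ≠ τ₀} → ℤ)) +
        Z.1.2.2.1 • (muNp1 n τ₀, (0 : {τ' : Ψ // τ' ≠ τ₀} → ℤ)) +
        (∑ τ : Ψ, ∑ i : Fin n,
          Z.1.2.2.2 τ i • (muGen n τ₀ τ i, (0 : {τ' : Ψ // τ' ≠ τ₀} → ℤ))) +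
        (∑ τ : {τ' : Ψ // τ' ≠ τ₀},
          Z.2 τ • (muGen n τ₀ τ.1 ⟨n - 1, by omega⟩, oneAt τ₀ τ)) := by
  have key : ∀ Z : (ℤ × ℤ × ℤ × (Ψ → Fin n → ℤ)) × ({τ' : Ψ // τ' ≠ τ₀} → ℤ), _ :=
    fun Z => comp_iff hn τ₀ κ j Z.1.2.2.2 Z.2 Z.1.1 Z.1.2.1 Z.1.2.2.1
  simp only [key]
  apply existsUnique_of_exists_of_unique
  · obtain ⟨c, hc⟩ : ∃ c : ℤ, c = w - κ.2 τ₀ ⟨n, by omega⟩ := ⟨_, rfl⟩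
    obtain ⟨g, hg⟩ : ∃ g : Ψ → ℕ → ℤ, g = fun τ k =>
      if hk : k < n then κ.2 τ ⟨k, by omega⟩ else if hτ : τ ≠ τ₀ then j ⟨τ, hτ⟩ else c := ⟨_, rfl⟩
    have g1 : ∀ τ k (hk : k < n), g τ k = κ.2 τ ⟨k, by omega⟩ := by
      intro τ k hk; simp [hg, hk]
    have g2 : ∀ τ (hτ : τ ≠ τ₀), g τ n = j ⟨τ, hτ⟩ := by
      intro τ hτ; simp [hg, hτ]
    have g3 : g τ₀ n = c := by simp [hg]
    obtain ⟨A, hA⟩ : ∃ A : Ψ → Fin n → ℤ, A = fun (τ : Ψ) (i : Fin n) =>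
      if τ = τ₀ ∧ (i : ℕ) = 0 then κ.2 τ₀ ⟨0, by omega⟩ else g τ i - g τ (i + 1) := ⟨_, rfl⟩
    have T1 : ∀ τ, τ ≠ τ₀ → ∀ k, k ≤ n → tailS (A τ) k = g τ k - g τ n := by
      intro τ hτ k hk
      exact tailS_tele _ (g τ) 0 (by intro i _; simp [hA, hτ]) k (by omega) hk
    have T0 : ∀ k, 1 ≤ k → k ≤ n → tailS (A τ₀) k = g τ₀ k - g τ₀ n := by
      intro k h1 hk
      refine tailS_tele _ (g τ₀) 1 ?_ k h1 hk
      intro i hi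
      have : ¬ (i : ℕ) = 0 := by omega
      simp only [hA, this, and_false, if_false]
    refine ⟨((κ.1, -w, c, A), j), ⟨by simpa using hw, by simp only [hc]; omega, ?_, fun τ => (hj τ).1⟩,
      rfl, rfl, ?_, ?_⟩
    · intro τ i h
      have hi := i.isLt
      have hne : ¬ (τ = τ₀ ∧ (i : ℕ) = 0) := by tauto
      simp only [hA, hne, if_false]
      rw [g1 τ i hi]
      by_cases hi' : (i : ℕ) + 1 < n
      · rw [g1 τ _ hi', sub_nonneg]
        by_cases hτ : τ = τ₀
        · subst hτ
          exact hdom₀ _ _ (by simp at h ⊢; omega) (by simp)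
        · exact hdom τ hτ _ _ (by simp)
      · have e : (i : ℕ) + 1 = n := by omega
        rw [e]
        by_cases hτ : τ = τ₀
        · subst hτ
          rw [g3, hc]
          have q1 := hpure₀ ⟨i, by omega⟩ (by simp at h ⊢; omega) (by simp)
          have q2 := hdom₀ ⟨n, by omega⟩ ⟨2 * n - i, by simp at h; omega⟩ (by simp; omega) (by simp; omega)
          simp only at q1 q2
          linarith
        · rw [g2 τ hτ]
          have q := (hj ⟨τ, hτ⟩).2
          have e' : (i : ℕ) = n - 1 := by omega
          simp only [e']
          linarith
    · intro k
      have hk := k.isLt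
      simp only
      split_ifs with h0 h
      · obtain ⟨k, hk'⟩ := k
        simp only at h0
        subst h0
        simp [hA]
      · rw [T0 k (by omega) (by omega), g3, g1 τ₀ k h]; simp
      · rw [T0 _ (by omega) (by omega), g3]
        by_cases e : (k : ℕ) = n
        · have e1 : κ.2 τ₀ k = κ.2 τ₀ ⟨n, by omega⟩ := congrArg _ (Fin.ext e)
          have e2 : 2 * n - (k : ℕ) = n := by omega
          rw [e1, e2, g3, hc]; ring
        · rw [g1 τ₀ _ (by omega)]
          have q1 := hpure₀ ⟨2 * n - k, by omega⟩ (by simp; omega) (by simp; omega)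
          have e2 : 2 * n - (2 * n - (k : ℕ)) = k := by omega
          simp only [e2, Fin.eta] at q1
          linarith
    · intro τ hτ k
      have hk := k.isLt
      simp only
      split_ifs with h
      · rw [T1 τ hτ k (by omega), g2 τ hτ, g1 τ k h]; simp
      · rw [T1 τ hτ _ (by omega), g2 τ hτ, g1 τ _ (by omega)]
        have q := hpure τ hτ k
        have e : k.rev = ⟨2 * n - 1 - k, by omega⟩ := Fin.ext (by simp [Fin.val_rev]; omega)
        rw [e] at q
        linarith
  · rintro ⟨⟨z, w1, c, A⟩, b⟩ ⟨⟨z', w1', c', A'⟩, b'⟩ ⟨-, hz, hb, h0, h1⟩ ⟨-, hz', hb', h0', h1'⟩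
    simp only at hz hb h0 h1 hz' hb' h0' h1'
    subst hz hz' hb hb'
    have Z := (h0 ⟨0, by omega⟩).symm.trans (h0' ⟨0, by omega⟩)
    have M := (h0 ⟨n, by omega⟩).symm.trans (h0' ⟨n, by omega⟩)
    have e2 : 2 * n - n = n := by omega
    have n0 : ¬ n = 0 := by omega
    simp only [if_true] at Z
    simp only [n0, if_false, lt_irrefl, e2, tailS_ge _ n le_rfl] at M
    have L : ∀ k, 1 ≤ k → k < n → c + tailS (A τ₀) k = c' + tailS (A' τ₀) k := by
      intro k hk1 hk
      have q := (h0 ⟨k, by omega⟩).symm.trans (h0' ⟨k, by omega⟩)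
      have k0 : ¬ k = 0 := by omega
      simpa only [k0, hk, if_true, if_false] using q
    have R : -w1 - c - tailS (A τ₀) 1 = -w1' - c' - tailS (A' τ₀) 1 := by
      have q := (h0 ⟨2 * n - 1, by omega⟩).symm.trans (h0' ⟨2 * n - 1, by omega⟩)
      have k0 : ¬ 2 * n - 1 = 0 := by omega
      have k1 : ¬ 2 * n - 1 < n := by omega
      have k2 : 2 * n - (2 * n - 1) = 1 := by omega
      simpa only [k0, k1, k2, if_true, if_false] using q
    have L1 := L 1 le_rfl (by omega)
    have hw1 : w1 = w1' := by linarith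
    have hc : c = c' := by linarith
    subst hw1 hc
    have hA : A = A' := by
      funext τ i
      have s := tailS_succ (A τ) i
      have s' := tailS_succ (A' τ) i
      have hi := i.isLt
      by_cases hτ : τ = τ₀
      · subst hτ
        by_cases hi0 : (i : ℕ) = 0
        · have : i = ⟨0, by omega⟩ := Fin.ext hi0
          rw [this]; exact Z
        · have q1 := L i (by omega) hi
          have q2 : tailS (A τ) (i + 1) = tailS (A' τ) (i + 1) := by
            by_cases hi1 : (i : ℕ) + 1 < n
            · have := L (i + 1) (by omega) hi1
              linarith
            · rw [tailS_ge _ _ (by omega), tailS_ge _ _ (by omega)]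
          linarith
      · have L' : ∀ k, k ≤ n → tailS (A τ) k = tailS (A' τ) k := by
          intro k hk
          by_cases hk' : k < n
          · have q := (h1 τ hτ ⟨k, by omega⟩).symm.trans (h1' τ hτ ⟨k, by omega⟩)
            simp only [hk', if_true] at q
            linarith
          · rw [tailS_ge _ _ (by omega), tailS_ge _ _ (by omega)]
        have q1 := L' i (by omega)
        have q2 := L' (i + 1) (by omega)
        linarith
    rw [hA]
end
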